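/- arXiv:1911.02563 — 3 statements merged into one kernel-verified Lean document; each statement's English description precedes it below -/
import Mathlib

section
/- For every natural number n ≥ 1, every natural number r ≥ 1, and every real number x with |x| < 1, the r-th moment of the n-th Meyer-König and Zeller operator has the representation (M_n e_r)(x) = 1 + (1/n!) · (1-x)^{n+1} · Σ_{s=1}^{r} (-1)^s · C(r,s) · n^s · Li_s^{(n)}(x), where Li_s^{(n)} denotes the n-th derivative of the polylogarithm Li_s and C(r,s) is the binomial coefficient. -/
/-- The Meyer-König and Zeller operator. -/
noncomputable def MKZ (n : ℕ) (f : ℝ → ℝ) (x : ℝ) : ℝ :=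
  (1 - x) ^ (n + 1) *
    ∑' ν : ℕ, (Nat.choose (ν + n) ν : ℝ) * f ((ν : ℝ) / ((ν : ℝ) + (n : ℝ))) * x ^ ν

/-- The polylogarithm Li_s(x) = Σ_{ν≥1} x^ν / ν^s. -/
noncomputable def Li (s : ℕ) (x : ℝ) : ℝ :=
  ∑' ν : ℕ, x ^ (ν + 1) / ((ν : ℝ) + 1) ^ s

/-- Bounded coefficients give a power series whose formal `j`-th derivative converges on `|x| < 1`. -/
lemma summable_descFactorial_mul_coeff {a : ℕ → ℝ} (ha : ∀ k, |a k| ≤ 1) (j : ℕ) {x : ℝ}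
    (hx : |x| < 1) :
    Summable fun k : ℕ => ((k + j).descFactorial j : ℝ) * a (k + j) * x ^ k := by
  have h := summable_descFactorial_mul_geometric_of_norm_lt_one (R := ℝ) j
    (r := |x|) (by simpa using hx)
  refine Summable.of_norm_bounded h fun k => ?_
  rw [norm_mul, norm_mul, norm_pow, Real.norm_eq_abs, Real.norm_eq_abs, Real.norm_eq_abs,
    Nat.abs_cast]
  gcongr
  exact mul_le_of_le_one_right (by positivity) (ha _)

lemma add_one_mul_descFactorial (k j : ℕ) :
    (k + 1) * (k + 1 + j).descFactorial j = (k + (j + 1)).descFactorial (j + 1) := by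
  rw [Nat.descFactorial_succ, show k + (j + 1) - j = k + 1 by omega,
    show k + (j + 1) = k + 1 + j by omega]

lemma hasDerivAt_tsum_descFactorial {a : ℕ → ℝ} (ha : ∀ k, |a k| ≤ 1) (j : ℕ) {x : ℝ}
    (hx : |x| < 1) :
    HasDerivAt (fun y => ∑' k : ℕ, ((k + j).descFactorial j : ℝ) * a (k + j) * y ^ k)
      (∑' k : ℕ, ((k + (j + 1)).descFactorial (j + 1) : ℝ) * a (k + (j + 1)) * x ^ k) x := by
  obtain ⟨ρ, hxρ, hρ⟩ := exists_between hx
  have hρ0 : 0 < ρ := (abs_nonneg x).trans_lt hxρ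
  have hmem : x ∈ Set.Ioo (-ρ) ρ := abs_lt.mp hxρ
  have hu : Summable fun k : ℕ => ((k + j).descFactorial j : ℝ) * (k * ρ ^ (k - 1)) := by
    rw [← summable_nat_add_iff 1]
    refine (summable_descFactorial_mul_geometric_of_norm_lt_one (R := ℝ) (j + 1)
      (r := ρ) (by rwa [Real.norm_eq_abs, abs_of_pos hρ0])).congr fun k => ?_
    rw [← add_one_mul_descFactorial]
    push_cast [Nat.add_sub_cancel]
    ring
  have key := hasDerivAt_tsum_of_isPreconnected
    (g := fun (k : ℕ) (y : ℝ) => ((k + j).descFactorial j : ℝ) * a (k + j) * y ^ k)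
    (g' := fun (k : ℕ) (y : ℝ) => ((k + j).descFactorial j : ℝ) * a (k + j) * (k * y ^ (k - 1)))
    hu isOpen_Ioo isPreconnected_Ioo
    (fun k y _ => (hasDerivAt_pow k y).const_mul _)
    (fun k y hy => by
      have hy' : |y| ≤ ρ := (abs_lt.mpr hy).le
      simp only [norm_mul, norm_pow, Real.norm_eq_abs, Nat.abs_cast]
      gcongr
      exact mul_le_of_le_one_right (by positivity) (ha _))
    hmem (summable_descFactorial_mul_coeff ha j hx) hmem
  refine key.congr_deriv ?_
  have hterm : ∀ k : ℕ, ((k + 1 + j).descFactorial j : ℝ) * a (k + 1 + j) *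
      ((k + 1 : ℕ) * x ^ (k + 1 - 1)) =
      ((k + (j + 1)).descFactorial (j + 1) : ℝ) * a (k + (j + 1)) * x ^ k := fun k => by
    rw [← add_one_mul_descFactorial, Nat.add_sub_cancel, show k + (j + 1) = k + 1 + j by omega]
    push_cast
    ring
  have hs := summable_descFactorial_mul_coeff ha (j + 1) hx
  rw [Summable.tsum_eq_zero_add
    ((summable_nat_add_iff 1).mp (hs.congr fun k => (hterm k).symm)), tsum_congr hterm]
  simp

lemma iteratedDeriv_tsum_mul_pow {a : ℕ → ℝ} (ha : ∀ k, |a k| ≤ 1) {f : ℝ → ℝ}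
    (hf : ∀ x, |x| < 1 → f x = ∑' k : ℕ, a k * x ^ k) (j : ℕ) {x : ℝ} (hx : |x| < 1) :
    iteratedDeriv j f x =
      ∑' k : ℕ, ((k + j).descFactorial j : ℝ) * a (k + j) * x ^ k := by
  induction j generalizing x with
  | zero => simpa using hf x hx
  | succ j ih =>
    have hev : iteratedDeriv j f =ᶠ[nhds x]
        fun y => ∑' k : ℕ, ((k + j).descFactorial j : ℝ) * a (k + j) * y ^ k := by
      filter_upwards [(isOpen_lt continuous_abs continuous_const).mem_nhds hx] with y hy
      exact ih hy
    rw [iteratedDeriv_succ, hev.deriv_eq, (hasDerivAt_tsum_descFactorial ha j hx).deriv]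

lemma abs_one_div_natCast_pow_le_one (s k : ℕ) : |1 / (k : ℝ) ^ s| ≤ 1 := by
  rw [abs_of_nonneg (by positivity), ← one_div_pow]
  exact pow_le_one₀ (by positivity) (by simpa using Nat.cast_inv_le_one k)

lemma Li_eq_tsum {s : ℕ} (hs : s ≠ 0) {x : ℝ} (hx : |x| < 1) :
    Li s x = ∑' k : ℕ, 1 / (k : ℝ) ^ s * x ^ k := by
  have h := summable_descFactorial_mul_coeff (abs_one_div_natCast_pow_le_one s) 0 hx
  rw [Summable.tsum_eq_zero_add (by simpa using h), Li]
  simp [hs, div_eq_inv_mul]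

lemma hasSum_iteratedDeriv_Li (n : ℕ) {s : ℕ} (hs : s ≠ 0) {x : ℝ} (hx : |x| < 1) :
    HasSum (fun k : ℕ => ((k + n).descFactorial n : ℝ) * (1 / ((k + n : ℕ) : ℝ) ^ s) * x ^ k)
      (iteratedDeriv n (Li s) x) := by
  rw [iteratedDeriv_tsum_mul_pow (abs_one_div_natCast_pow_le_one s)
    (fun _ hy => Li_eq_tsum hs hy) n hx]
  exact (summable_descFactorial_mul_coeff (abs_one_div_natCast_pow_le_one s) n hx).hasSum

theorem mkz_moment_repr (n r : ℕ) (hn : 1 ≤ n) (hr : 1 ≤ r) (x : ℝ) (hx : |x| < 1) :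
    MKZ n (fun t => t ^ r) x =
      1 + (1 / (Nat.factorial n : ℝ)) * (1 - x) ^ (n + 1) *
        ∑ s ∈ Finset.Icc 1 r,
          (-1 : ℝ) ^ s * (Nat.choose r s : ℝ) * (n : ℝ) ^ s * iteratedDeriv n (Li s) x := by
  have hx1 : (1 - x) ^ (n + 1) ≠ 0 := pow_ne_zero _ (by linarith [(abs_lt.mp hx).2])
  have h0 : HasSum (fun k : ℕ => ((k + n).choose n : ℝ) * x ^ k) (1 / (1 - x) ^ (n + 1)) :=
    hasSum_choose_mul_geometric_of_norm_lt_one n (by simpa using hx)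
  have h1 : HasSum (fun k : ℕ => ∑ s ∈ Finset.Icc 1 r,
      (-1 : ℝ) ^ s * (Nat.choose r s : ℝ) * (n : ℝ) ^ s *
        (((k + n).descFactorial n : ℝ) * (1 / ((k + n : ℕ) : ℝ) ^ s) * x ^ k)) _ :=
    hasSum_sum fun s hs =>
      (hasSum_iteratedDeriv_Li n (Nat.one_le_iff_ne_zero.mp (Finset.mem_Icc.mp hs).1) hx).mul_left
        ((-1 : ℝ) ^ s * (Nat.choose r s : ℝ) * (n : ℝ) ^ s)
  have h2 := h0.add (h1.mul_left (1 / (Nat.factorial n : ℝ)))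
  have hterm : ∀ k : ℕ,
      (Nat.choose (k + n) k : ℝ) * ((k : ℝ) / ((k : ℝ) + (n : ℝ))) ^ r * x ^ k =
      ((k + n).choose n : ℝ) * x ^ k + 1 / (Nat.factorial n : ℝ) * ∑ s ∈ Finset.Icc 1 r,
        (-1 : ℝ) ^ s * (Nat.choose r s : ℝ) * (n : ℝ) ^ s *
          (((k + n).descFactorial n : ℝ) * (1 / ((k + n : ℕ) : ℝ) ^ s) * x ^ k) := fun k => by
    have hkn : (k : ℝ) + n ≠ 0 := by positivity
    have hfac : (n.factorial : ℝ) ≠ 0 := by positivity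
    have hbin : ((k : ℝ) / ((k : ℝ) + n)) ^ r = 1 + ∑ s ∈ Finset.Icc 1 r,
        (-1 : ℝ) ^ s * (Nat.choose r s : ℝ) * (n : ℝ) ^ s * (1 / ((k : ℝ) + n) ^ s) := by
      rw [show (k : ℝ) / ((k : ℝ) + n) = -(n / ((k : ℝ) + n)) + 1 by field_simp; ring,
        add_pow, Finset.range_eq_Ico, Finset.sum_eq_sum_Ico_succ_bot (by omega)]
      simp only [pow_zero, one_pow, Nat.choose_zero_right, Nat.cast_one, mul_one, zero_add]
      rw [Finset.Ico_add_one_right_eq_Icc]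
      congr 1
      refine Finset.sum_congr rfl fun s _ => ?_
      rw [neg_pow, div_pow]
      ring
    rw [Nat.choose_symm_add, hbin, Nat.descFactorial_eq_factorial_mul_choose, mul_add, add_mul,
      mul_one, Finset.mul_sum, Finset.mul_sum, Finset.sum_mul]
    congr 1
    refine Finset.sum_congr rfl fun s _ => ?_
    push_cast
    field_simp
  simp only [MKZ]
  rw [tsum_congr hterm, h2.tsum_eq, mul_add, mul_one_div_cancel hx1]
  ring
end

section
/- For every natural number n ≥ 1 and every real number x with 0 < |x| < 1, the n-th derivative of the dilogarithm Li_2 satisfies Li_2^{(n)}(x) = (-1)^n · ((n-1)!/x^n) · log(1-x) + ((n-1)!/x^n) · Σ_{k=1}^{n-1} (-1)^{n-1-k} · (1/k) · (x/(1-x))^k. -/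
theorem Li_two_hasDerivAt {x : ℝ} (hx0 : x ≠ 0) (hx1 : |x| < 1) :
    HasDerivAt (Li 2) (-Real.log (1 - x) / x) x := by
  obtain ⟨r, hxr, hr1⟩ := exists_between hx1
  have hr0 : 0 < r := (abs_nonneg x).trans_lt hxr
  have key : HasDerivAt (fun z : ℝ => ∑' ν : ℕ, z ^ (ν + 1) / ((ν : ℝ) + 1) ^ 2)
      (∑' ν : ℕ, x ^ ν / ((ν : ℝ) + 1)) x := by
    refine hasDerivAt_tsum_of_isPreconnected
      (g := fun (ν : ℕ) (z : ℝ) => z ^ (ν + 1) / ((ν : ℝ) + 1) ^ 2)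
      (g' := fun (ν : ℕ) (z : ℝ) => z ^ ν / ((ν : ℝ) + 1)) (t := Metric.ball 0 r) (y₀ := 0)
      (summable_geometric_of_lt_one hr0.le hr1) Metric.isOpen_ball
      (convex_ball (0 : ℝ) r).isPreconnected ?_ ?_ (Metric.mem_ball_self hr0) ?_ ?_
    · intro ν y _
      refine ((hasDerivAt_pow (ν + 1) y).div_const (((ν : ℝ) + 1) ^ 2)).congr_deriv ?_
      have : (ν : ℝ) + 1 ≠ 0 := by positivity
      push_cast [Nat.add_sub_cancel]
      field_simp
    · intro ν y hy
      have hy : |y| < r := by simpa using hy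
      have hν : (1 : ℝ) ≤ (ν : ℝ) + 1 := by simp
      rw [Real.norm_eq_abs, abs_div, abs_pow, abs_of_pos (zero_lt_one.trans_le hν)]
      exact (div_le_self (by positivity) hν).trans (pow_le_pow_left₀ (abs_nonneg y) hy.le ν)
    · simp
    · simpa using hxr
  have hsum : ∑' ν : ℕ, x ^ ν / ((ν : ℝ) + 1) = -Real.log (1 - x) / x := by
    rw [← ((Real.hasSum_pow_div_log_of_abs_lt_one hx1).div_const x).tsum_eq]
    refine tsum_congr fun ν => ?_
    rw [pow_succ]
    field_simp
  rw [hsum] at key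
  exact key

/-- The logarithm of `1 - x` minus a partial sum of its expansion in powers of `x / (1 - x)`. -/
noncomputable def logRemainder (m : ℕ) (x : ℝ) : ℝ :=
  Real.log (1 - x) - ∑ k ∈ Finset.range m, (-(x / (1 - x))) ^ (k + 1) / ((k : ℝ) + 1)

theorem logRemainder_succ (m : ℕ) (x : ℝ) :
    logRemainder (m + 1) x = logRemainder m x - (-(x / (1 - x))) ^ (m + 1) / ((m : ℝ) + 1) := by
  rw [logRemainder, logRemainder, Finset.sum_range_succ]
  ring

theorem logRemainder_hasDerivAt (m : ℕ) {x : ℝ} (hx : 1 - x ≠ 0) :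
    HasDerivAt (logRemainder m) (-(-(x / (1 - x))) ^ m / (1 - x)) x := by
  have hsub : HasDerivAt (fun y : ℝ => 1 - y) (-1) x := (hasDerivAt_id x).const_sub 1
  induction m with
  | zero =>
    have h0 : logRemainder 0 = fun y => Real.log (1 - y) := by
      funext y
      simp [logRemainder]
    rw [h0, pow_zero]
    exact hsub.log hx
  | succ m ih =>
    have hu : HasDerivAt (fun y : ℝ => -(y / (1 - y))) (-(1 / (1 - x) ^ 2)) x := by
      refine ((hasDerivAt_id x).div hsub hx).neg.congr_deriv ?_
      simp
    rw [funext (logRemainder_succ m)]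
    refine (ih.sub ((hu.pow (m + 1)).div_const ((m : ℝ) + 1))).congr_deriv ?_
    have : (m : ℝ) + 1 ≠ 0 := by positivity
    rw [Nat.add_sub_cancel, pow_succ (-(x / (1 - x)))]
    generalize (-(x / (1 - x))) ^ m = p
    push_cast
    field_simp
    ring

theorem iteratedDeriv_succ_Li_two (m : ℕ) {x : ℝ} (hx0 : x ≠ 0) (hx1 : |x| < 1) :
    iteratedDeriv (m + 1) (Li 2) x =
      (-1) ^ (m + 1) * (m.factorial / x ^ (m + 1)) * logRemainder m x := by
  induction m generalizing x with
  | zero =>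
    rw [zero_add, iteratedDeriv_one, (Li_two_hasDerivAt hx0 hx1).deriv]
    simp [logRemainder]
    ring
  | succ m ih =>
    have hx : 1 - x ≠ 0 := (sub_pos.mpr (abs_lt.mp hx1).2).ne'
    have hev : iteratedDeriv (m + 1) (Li 2) =ᶠ[nhds x] fun y =>
        (-1) ^ (m + 1) * (m.factorial / y ^ (m + 1)) * logRemainder m y := by
      filter_upwards [isOpen_ne.mem_nhds hx0, (isOpen_lt continuous_abs continuous_const).mem_nhds hx1]
        with y hy0 hy1 using ih hy0 hy1
    have hd : HasDerivAt (fun y : ℝ => (-1) ^ (m + 1) * (m.factorial / y ^ (m + 1)))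
        ((-1) ^ (m + 2) * ((m + 1).factorial / x ^ (m + 2))) x := by
      refine (((hasDerivAt_const x (m.factorial : ℝ)).div (hasDerivAt_pow (m + 1) x)
        (pow_ne_zero _ hx0)).const_mul ((-1 : ℝ) ^ (m + 1))).congr_deriv ?_
      rw [Nat.factorial_succ, Nat.add_sub_cancel]
      push_cast
      field_simp
      ring
    rw [iteratedDeriv_succ, hev.deriv_eq, (hd.fun_mul (logRemainder_hasDerivAt m hx)).deriv,
      logRemainder_succ, Nat.factorial_succ]
    have : (m : ℝ) + 1 ≠ 0 := by positivity
    rw [pow_succ (-(x / (1 - x)))]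
    generalize (-(x / (1 - x))) ^ m = p
    push_cast
    field_simp
    ring

theorem polylog_two_iteratedDeriv (n : ℕ) (hn : 1 ≤ n) (x : ℝ) (hx0 : 0 < |x|)
    (hx1 : |x| < 1) :
    iteratedDeriv n (Li 2) x =
      (-1 : ℝ) ^ n * ((Nat.factorial (n - 1) : ℝ) / x ^ n) * Real.log (1 - x) +
        ((Nat.factorial (n - 1) : ℝ) / x ^ n) *
          ∑ k ∈ Finset.Icc 1 (n - 1),
            (-1 : ℝ) ^ (n - 1 - k) * (1 / (k : ℝ)) * (x / (1 - x)) ^ k := by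
  obtain ⟨m, rfl⟩ := Nat.exists_eq_add_of_le' hn
  have hsum : ∑ k ∈ Finset.Icc 1 m, (-1 : ℝ) ^ (m - k) * (1 / (k : ℝ)) * (x / (1 - x)) ^ k =
      (-1) ^ m * ∑ k ∈ Finset.range m, (-(x / (1 - x))) ^ (k + 1) / ((k : ℝ) + 1) := by
    rw [Finset.range_eq_Ico, Finset.mul_sum, ← Finset.Ico_add_one_right_eq_Icc,
      ← Finset.sum_Ico_add' _ 0 m 1]
    refine Finset.sum_congr rfl fun k hk => ?_
    have hsign : (-1 : ℝ) ^ m * (-1) ^ (k + 1) = (-1) ^ (m - (k + 1)) := by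
      obtain ⟨j, rfl⟩ := Nat.exists_eq_add_of_le (Nat.succ_le_of_lt (Finset.mem_Ico.mp hk).2)
      rw [Nat.succ_eq_add_one, Nat.add_sub_cancel_left, pow_add, mul_right_comm, ← mul_pow]
      simp
    rw [neg_pow (x / (1 - x)), ← hsign]
    push_cast
    ring
  rw [iteratedDeriv_succ_Li_two m (abs_pos.mp hx0) hx1, Nat.add_sub_cancel, hsum, logRemainder]
  ring
end

section
/- For every natural number n ≥ 1 and every real number x with 0 < |x| < 1, the second moment of the n-th Meyer-König and Zeller operator has the elementary representation (M_n e_2)(x) = (-1)^n · (n · (1-x)^{n+1} / x^n) · log(1-x) + 2x - 1 + n · (1-x) · Σ_{k=1}^{n-1} (-1)^{n-1-k} · (1/k) · ((1-x)/x)^{n-k}. -/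
/-- The base case of the closed form below: the Mercator series divided by `x`. -/
theorem hasSum_pow_div_succ {x : ℝ} (hx0 : x ≠ 0) (hx1 : |x| < 1) :
    HasSum (fun ν : ℕ => x ^ ν / ((ν : ℝ) + 1)) (-Real.log (1 - x) / x) := by
  refine (congrArg (fun f => HasSum f _) (funext fun ν => ?_)).mpr
    ((Real.hasSum_pow_div_log_of_abs_lt_one hx1).div_const x)
  field_simp
  ring

/-- The closed form of
`∑ C(ν + n, n) x ^ ν / (ν + n + 1) = x ^ (-n - 1) ∫₀ˣ tⁿ (1 - t) ^ (-n - 1)`. -/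
theorem hasSum_choose_mul_pow_div {x : ℝ} (hx0 : x ≠ 0) (hx1 : |x| < 1) (n : ℕ) :
    HasSum (fun ν : ℕ => ((ν + n).choose n : ℝ) * x ^ ν / ((ν : ℝ) + n + 1))
      ((-1) ^ (n + 1) * Real.log (1 - x) / x ^ (n + 1) +
        (∑ k ∈ Finset.Icc 1 n, (-1 : ℝ) ^ (n - k) * (1 / (k : ℝ)) * ((1 - x) / x) ^ (n + 1 - k)) /
          (1 - x) ^ (n + 1)) := by
  have hx : 1 - x ≠ 0 := by linarith [(abs_lt.1 hx1).2]
  induction n with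
  | zero => simpa using hasSum_pow_div_succ hx0 hx1
  | succ n ih =>
    have geom := (hasSum_choose_mul_geometric_of_norm_lt_one n
      (by simpa using hx1 : ‖x‖ < 1)).div_const ((n : ℝ) + 1)
    have shifted := ((hasSum_nat_add_iff' 1).2 (geom.sub ih)).div_const x
    refine (congrArg₂ (fun f a => HasSum f a) (funext fun ν => ?_) ?_).mpr shifted
    · have pascal : ((ν + 1 + n).choose (n + 1) : ℝ) + ((ν + 1 + n).choose n : ℝ) =
          ((ν + 1 + n + 1).choose (n + 1) : ℝ) := by
        rw [add_comm]; exact_mod_cast (Nat.choose_succ_succ (ν + 1 + n) n).symm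
      have absorb : ((ν : ℝ) + 1 + n + 1) * ((ν + 1 + n).choose n : ℝ) =
          ((ν + 1 + n + 1).choose (n + 1) : ℝ) * ((n : ℝ) + 1) := by
        exact_mod_cast Nat.add_one_mul_choose_eq (ν + 1 + n) n
      rw [← pascal] at absorb
      have hn : (n : ℝ) + 1 ≠ 0 := by positivity
      have hν : (ν : ℝ) + 1 + n + 1 ≠ 0 := by positivity
      rw [show ν + (n + 1) = ν + 1 + n by ring]
      push_cast
      rw [show (ν : ℝ) + (n + 1) + 1 = ν + 1 + n + 1 by ring]
      field_simp
      linear_combination -(x ^ (ν + 1)) * absorb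
    · have step : ∑ k ∈ Finset.Icc 1 n,
            (-1 : ℝ) ^ (n + 1 - k) * (1 / (k : ℝ)) * ((1 - x) / x) ^ (n + 1 + 1 - k) =
          -((1 - x) / x) * ∑ k ∈ Finset.Icc 1 n,
            (-1 : ℝ) ^ (n - k) * (1 / (k : ℝ)) * ((1 - x) / x) ^ (n + 1 - k) := by
        rw [Finset.mul_sum]
        refine Finset.sum_congr rfl fun k hk => ?_
        have hkn := (Finset.mem_Icc.1 hk).2
        rw [show n + 1 - k = n - k + 1 by omega, show n + 1 + 1 - k = n - k + 1 + 1 by omega]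
        ring
      rw [Finset.sum_Icc_succ_top (by omega), step]
      have hn : (n : ℝ) + 1 ≠ 0 := by positivity
      generalize ∑ k ∈ Finset.Icc 1 n,
        (-1 : ℝ) ^ (n - k) * (1 / (k : ℝ)) * ((1 - x) / x) ^ (n + 1 - k) = S
      simp
      field_simp
      ring

theorem mkz_second_moment_elementary (n : ℕ) (hn : 1 ≤ n) (x : ℝ) (hx0 : 0 < |x|)
    (hx1 : |x| < 1) :
    MKZ n (fun t => t ^ 2) x =
      (-1 : ℝ) ^ n * ((n : ℝ) * (1 - x) ^ (n + 1) / x ^ n) * Real.log (1 - x) +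
        2 * x - 1 + (n : ℝ) * (1 - x) *
          ∑ k ∈ Finset.Icc 1 (n - 1),
            (-1 : ℝ) ^ (n - 1 - k) * (1 / (k : ℝ)) * ((1 - x) / x) ^ (n - k) := by
  obtain ⟨m, rfl⟩ : ∃ m, n = m + 1 := ⟨n - 1, by omega⟩
  have hx0' : x ≠ 0 := abs_pos.1 hx0
  have hx : 1 - x ≠ 0 := by linarith [(abs_lt.1 hx1).2]
  have hnorm : ‖x‖ < 1 := by simpa using hx1
  have key := ((hasSum_choose_mul_geometric_of_norm_lt_one (m + 1) hnorm).sub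
    ((hasSum_choose_mul_geometric_of_norm_lt_one m hnorm).mul_left 2)).add
    ((hasSum_choose_mul_pow_div hx0' hx1 m).mul_left ((m : ℝ) + 1))
  have terms (ν : ℕ) : ((ν + (m + 1)).choose ν : ℝ) *
      ((ν : ℝ) / ((ν : ℝ) + ((m + 1 : ℕ) : ℝ))) ^ 2 * x ^ ν =
      ((ν + (m + 1)).choose (m + 1) : ℝ) * x ^ ν - 2 * (((ν + m).choose m : ℝ) * x ^ ν) +
        ((m : ℝ) + 1) * (((ν + m).choose m : ℝ) * x ^ ν / ((ν : ℝ) + m + 1)) := by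
    have absorb : ((ν : ℝ) + m + 1) * ((ν + m).choose m : ℝ) =
        ((ν + (m + 1)).choose (m + 1) : ℝ) * ((m : ℝ) + 1) := by
      exact_mod_cast Nat.add_one_mul_choose_eq (ν + m) m
    have hν : (ν : ℝ) + m + 1 ≠ 0 := by positivity
    have hm : (m : ℝ) + 1 ≠ 0 := by positivity
    rw [Nat.choose_symm_add, (eq_div_iff hm).2 absorb.symm]
    push_cast
    rw [← add_assoc]
    field_simp
    ring
  rw [MKZ, tsum_congr terms, key.tsum_eq]
  simp only [Nat.add_sub_cancel]
  generalize ∑ k ∈ Finset.Icc 1 m,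
    (-1 : ℝ) ^ (m - k) * (1 / (k : ℝ)) * ((1 - x) / x) ^ (m + 1 - k) = S
  push_cast
  field_simp
  ring
end
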